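/- Let n, p ∈ ℕ and δ₁, δ₂ ≥ 0. Let g₁ : C([−δ₁,0],ℝⁿ) × C([−δ₂,0],ℝᵖ) → ℝⁿ and g₂ : C([−δ₂,0],ℝᵖ) × C([−δ₁,0],ℝⁿ) → ℝᵖ be Lipschitz continuous on bounded sets with g₁(0,0) = 0 and g₂(0,0) = 0, and consider the coupled retarded system ẋ(t) = g₁(x_t, e_t), ė(t) = g₂(e_t, x_t) with initial states ψ ∈ C([−δ₁,0],ℝⁿ), φ ∈ C([−δ₂,0],ℝᵖ); a solution is a pair of continuous functions x : [−δ₁,∞) → ℝⁿ, e : [−δ₂,∞) → ℝᵖ, differentiable on [0,∞), satisfying these equations for all t ≥ 0 together with the initial conditions. Suppose there exist class-KL functions β₁, β₂ and a class-K function γ₁ such that every solution satisfies ‖x(t)‖ ≤ β₁(‖ψ‖_c, t) + γ₁( sup_{0≤s≤t} ‖e_s‖_c ) and ‖e(t)‖ ≤ β₂(‖φ‖_c, t) for all t ≥ 0. Then there exists a class-KL function β such that every solution satisfies ‖(x(t), e(t))‖ ≤ β( ‖(ψ, φ)‖_c, t ) for all t ≥ 0, where ‖(ψ,φ)‖_c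 := max{ sup_{θ∈[−δ₁,0]}‖ψ(θ)‖, sup_{θ∈[−δ₂,0]}‖φ(θ)‖ } and ‖(x(t),e(t))‖ is the Euclidean norm of the concatenated vector. -/

import Mathlib

open Set Filter Topology

/-- The history segment `x_t ∈ C([-δ,0], E)` of a continuous function `x : ℝ → E`,
defined by `x_t(θ) = x(t+θ)` for `θ ∈ [-δ,0]`. -/
noncomputable def seg {E : Type*} [TopologicalSpace E] (δ : ℝ) (x : ℝ → E) (hx : Continuous x)
    (t : ℝ) : C(Set.Icc (-δ) (0:ℝ), E) :=
  ⟨fun θ => x (t + θ.1), hx.comp (continuous_const.add continuous_subtype_val)⟩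

/-- A function `γ : [0,∞) → [0,∞)` is of class K if it is continuous, strictly
increasing and `γ(0) = 0`. -/
def ClassK (γ : ℝ → ℝ) : Prop :=
  ContinuousOn γ (Set.Ici 0) ∧ StrictMonoOn γ (Set.Ici 0) ∧ γ 0 = 0

/-- A function `β : [0,∞) × [0,∞) → [0,∞)` is of class KL if `β(·,t)` is of class K
for each `t ≥ 0`, and `β(s,·)` is nonincreasing with limit `0` at `∞` for each `s ≥ 0`. -/
def ClassKL (β : ℝ → ℝ → ℝ) : Prop :=
  (∀ t, 0 ≤ t → ClassK fun s => β s t) ∧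
  (∀ s, 0 ≤ s → AntitoneOn (β s) (Set.Ici 0) ∧ Filter.Tendsto (β s) Filter.atTop (nhds 0))


lemma ClassK.nonneg' {γ : ℝ → ℝ} (h : ClassK γ) {s : ℝ} (hs : 0 ≤ s) : 0 ≤ γ s := by
  have := h.2.1.monotoneOn (mem_Ici.2 le_rfl) (mem_Ici.2 hs) hs
  rwa [h.2.2] at this

lemma ClassK.mono' {γ : ℝ → ℝ} (h : ClassK γ) {s t : ℝ} (hs : 0 ≤ s) (hst : s ≤ t) :
    γ s ≤ γ t :=
  h.2.1.monotoneOn (mem_Ici.2 hs) (mem_Ici.2 (hs.trans hst)) hst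

lemma ClassK.add' {γ η : ℝ → ℝ} (h : ClassK γ) (h' : ClassK η) :
    ClassK (fun s => γ s + η s) :=
  ⟨h.1.add h'.1, fun _ ha _ hb hab => add_lt_add (h.2.1 ha hb hab) (h'.2.1 ha hb hab),
    by simp [h.2.2, h'.2.2]⟩

lemma ClassK.comp' {γ η : ℝ → ℝ} (h : ClassK γ) (h' : ClassK η) :
    ClassK (fun s => γ (η s)) :=
  ⟨h.1.comp h'.1 (fun _ hs => h'.nonneg' hs),
    fun _ ha _ hb hab => h.2.1 (h'.nonneg' ha) (h'.nonneg' hb) (h'.2.1 ha hb hab),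
    by simp [h.2.2, h'.2.2]⟩

lemma classK_mul_const {c : ℝ} (hc : 0 < c) : ClassK (fun s => s * c) :=
  ⟨by fun_prop, fun _ _ _ _ hab => mul_lt_mul_of_pos_right hab hc, by simp⟩

lemma ClassKL.add' {β η : ℝ → ℝ → ℝ} (h : ClassKL β) (h' : ClassKL η) :
    ClassKL (fun s t => β s t + η s t) :=
  ⟨fun t ht => (h.1 t ht).add' (h'.1 t ht), fun s hs =>
    ⟨(h.2 s hs).1.add (h'.2 s hs).1, by simpa using (h.2 s hs).2.add (h'.2 s hs).2⟩⟩

lemma ClassKL.comp_left' {β : ℝ → ℝ → ℝ} {γ : ℝ → ℝ} (h : ClassKL β) (hγ : ClassK γ) :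
    ClassKL (fun s t => γ (β s t)) := by
  refine ⟨fun t ht => hγ.comp' (h.1 t ht), fun s hs => ⟨?_, ?_⟩⟩
  · intro a ha b hb hab
    exact hγ.mono' ((h.1 b hb).nonneg' hs) ((h.2 s hs).1 ha hb hab)
  · have h1 : Tendsto γ (𝓝[Ici 0] 0) (𝓝 0) := by
      have := hγ.1 0 (mem_Ici.2 le_rfl)
      rwa [ContinuousWithinAt, hγ.2.2] at this
    refine h1.comp (tendsto_nhdsWithin_iff.2 ⟨(h.2 s hs).2, ?_⟩)
    filter_upwards [eventually_ge_atTop 0] with t ht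
    exact (h.1 t ht).nonneg' hs

lemma ClassKL.comp_right' {β : ℝ → ℝ → ℝ} {γ σ : ℝ → ℝ} (h : ClassKL β) (hγ : ClassK γ)
    (hσ : Monotone σ) (hσ0 : ∀ t, 0 ≤ t → 0 ≤ σ t) (hσt : Tendsto σ atTop atTop) :
    ClassKL (fun s t => β (γ s) (σ t)) :=
  ⟨fun t ht => (h.1 (σ t) (hσ0 t ht)).comp' hγ, fun s hs =>
    ⟨fun a ha b hb hab => (h.2 _ (hγ.nonneg' hs)).1 (hσ0 a ha) (hσ0 b hb) (hσ hab),
      (h.2 _ (hγ.nonneg' hs)).2.comp hσt⟩⟩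

lemma classK_id : ClassK (fun s => s) :=
  ⟨continuousOn_id, fun _ _ _ _ hab => hab, rfl⟩

lemma classKL_exp (d : ℝ) : ClassKL (fun s t => s * Real.exp (d - t)) := by
  refine ⟨fun t _ => classK_mul_const (Real.exp_pos _), fun s hs => ⟨?_, ?_⟩⟩
  · intro a _ b _ hab
    have : Real.exp (d - b) ≤ Real.exp (d - a) := Real.exp_le_exp.2 (by linarith)
    exact mul_le_mul_of_nonneg_left this hs
  · have h1 : Tendsto (fun t : ℝ => d - t) atTop atBot := by
      simpa [sub_eq_add_neg] using tendsto_atBot_add_const_left atTop d tendsto_neg_atTop_atBot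
    simpa using (Real.tendsto_exp_atBot.comp h1).const_mul s

lemma seg_shift {E : Type*} [TopologicalSpace E] (δ : ℝ) (x : ℝ → E) (hx : Continuous x)
    (s t : ℝ) (hx' : Continuous fun u => x (u + s)) :
    seg δ (fun u => x (u + s)) hx' t = seg δ x hx (t + s) := by
  ext1 θ
  simp only [seg, ContinuousMap.coe_mk]
  congr 1
  ring

lemma norm_le_seg_zero {E : Type*} [NormedAddCommGroup E] {δ : ℝ} (x : ℝ → E)
    (hx : Continuous x) {u : ℝ} (h1 : -δ ≤ u) (h2 : u ≤ 0) : ‖x u‖ ≤ ‖seg δ x hx 0‖ := by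
  have := (seg δ x hx 0).norm_coe_le_norm ⟨u, h1, h2⟩
  simpa [seg] using this

lemma seg_norm_le {E : Type*} [NormedAddCommGroup E] {δ : ℝ} (x : ℝ → E)
    (hx : Continuous x) {t C : ℝ} (hC : 0 ≤ C)
    (h : ∀ θ, -δ ≤ θ → θ ≤ 0 → ‖x (t + θ)‖ ≤ C) : ‖seg δ x hx t‖ ≤ C :=
  (ContinuousMap.norm_le _ hC).2 fun θ => h θ.1 θ.2.1 θ.2.2

/-- Lemma 4 (cascade lemma): for the coupled retarded system
`ẋ(t) = g₁(x_t, e_t)`, `ė(t) = g₂(e_t, x_t)`, if `x` satisfies an ISS-type bound with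
respect to `e` and `e` converges via a class-KL bound, then the combined state satisfies
a class-KL bound. -/
theorem cascade_KL_lemma
    (n p : ℕ) (δ₁ δ₂ : ℝ) (hδ₁ : 0 ≤ δ₁) (hδ₂ : 0 ≤ δ₂)
    (g₁ : C(Set.Icc (-δ₁) (0:ℝ), EuclideanSpace ℝ (Fin n)) →
      C(Set.Icc (-δ₂) (0:ℝ), EuclideanSpace ℝ (Fin p)) → EuclideanSpace ℝ (Fin n))
    (g₂ : C(Set.Icc (-δ₂) (0:ℝ), EuclideanSpace ℝ (Fin p)) →
      C(Set.Icc (-δ₁) (0:ℝ), EuclideanSpace ℝ (Fin n)) → EuclideanSpace ℝ (Fin p))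
    (hg₁0 : g₁ 0 0 = 0) (hg₂0 : g₂ 0 0 = 0)
    -- Lipschitz continuity on bounded sets:
    (hg₁Lip : ∀ B, Bornology.IsBounded B → ∃ K : NNReal,
      LipschitzOnWith K (fun q : C(Set.Icc (-δ₁) (0:ℝ), EuclideanSpace ℝ (Fin n)) ×
        C(Set.Icc (-δ₂) (0:ℝ), EuclideanSpace ℝ (Fin p)) => g₁ q.1 q.2) B)
    (hg₂Lip : ∀ B, Bornology.IsBounded B → ∃ K : NNReal,
      LipschitzOnWith K (fun q : C(Set.Icc (-δ₂) (0:ℝ), EuclideanSpace ℝ (Fin p)) ×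
        C(Set.Icc (-δ₁) (0:ℝ), EuclideanSpace ℝ (Fin n)) => g₂ q.1 q.2) B)
    (β₁ β₂ : ℝ → ℝ → ℝ) (γ₁ : ℝ → ℝ)
    (hβ₁ : ClassKL β₁) (hβ₂ : ClassKL β₂) (hγ₁ : ClassK γ₁)
    -- every solution satisfies the two bounds:
    (hbounds : ∀ (x : ℝ → EuclideanSpace ℝ (Fin n)) (e : ℝ → EuclideanSpace ℝ (Fin p))
        (hx : Continuous x) (he : Continuous e),
      (∀ t, 0 ≤ t → HasDerivAt x (g₁ (seg δ₁ x hx t) (seg δ₂ e he t)) t) →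
      (∀ t, 0 ≤ t → HasDerivAt e (g₂ (seg δ₂ e he t) (seg δ₁ x hx t)) t) →
      ∀ t, 0 ≤ t →
        ‖x t‖ ≤ β₁ ‖seg δ₁ x hx 0‖ t +
            γ₁ (sSup ((fun s => ‖seg δ₂ e he s‖) '' Set.Icc 0 t)) ∧
        ‖e t‖ ≤ β₂ ‖seg δ₂ e he 0‖ t) :
    ∃ β : ℝ → ℝ → ℝ, ClassKL β ∧
      ∀ (x : ℝ → EuclideanSpace ℝ (Fin n)) (e : ℝ → EuclideanSpace ℝ (Fin p))
        (hx : Continuous x) (he : Continuous e),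
        (∀ t, 0 ≤ t → HasDerivAt x (g₁ (seg δ₁ x hx t) (seg δ₂ e he t)) t) →
        (∀ t, 0 ≤ t → HasDerivAt e (g₂ (seg δ₂ e he t) (seg δ₁ x hx t)) t) →
        ∀ t, 0 ≤ t →
          Real.sqrt (‖x t‖ ^ 2 + ‖e t‖ ^ 2) ≤
            β (max ‖seg δ₁ x hx 0‖ ‖seg δ₂ e he 0‖) t := by
  set η : ℝ → ℝ → ℝ := fun s t => β₂ s (max (t - δ₂) 0) + s * Real.exp (δ₂ - t) with hη
  have hηKL : ClassKL η := by
    refine ClassKL.add' (hβ₂.comp_right' (σ := fun t => max (t - δ₂) 0) classK_id ?_ ?_ ?_)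
      (classKL_exp δ₂)
    · intro a b hab
      exact max_le_max (by linarith) le_rfl
    · intro t _
      exact le_max_right _ _
    · refine tendsto_atTop_mono (fun t => le_max_left (t - δ₂) 0) ?_
      exact tendsto_atTop_add_const_right atTop (-δ₂) tendsto_id
  set M : ℝ → ℝ := fun s => s + (β₁ s 0 + γ₁ (η s 0)) with hM
  have hMK : ClassK M :=
    classK_id.add' ((hβ₁.1 0 le_rfl).add' (hγ₁.comp' (hηKL.1 0 le_rfl)))
  have hhalf : Monotone fun t : ℝ => t / 2 := fun a b hab => by
    show a / 2 ≤ b / 2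
    linarith
  have hhalf0 : ∀ t : ℝ, 0 ≤ t → 0 ≤ t / 2 := fun t ht => by linarith
  have hhalft : Tendsto (fun t : ℝ => t / 2) atTop atTop :=
    tendsto_id.atTop_div_const (by norm_num)
  refine ⟨fun s t => (β₁ (M s) (t / 2) + γ₁ (η s (t / 2))) + β₂ s t,
    ((hβ₁.comp_right' hMK hhalf hhalf0 hhalft).add'
      ((hηKL.comp_left' hγ₁).comp_right' classK_id hhalf hhalf0 hhalft)).add' hβ₂, ?_⟩
  intro x e hx he hdx hde t ht
  set r := max ‖seg δ₁ x hx 0‖ ‖seg δ₂ e he 0‖ with hr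
  have hψ : ‖seg δ₁ x hx 0‖ ≤ r := le_max_left _ _
  have hφ : ‖seg δ₂ e he 0‖ ≤ r := le_max_right _ _
  have hr0 : 0 ≤ r := (norm_nonneg _).trans hψ
  have B := hbounds x e hx he hdx hde
  -- decay of e
  have he1 : ∀ u, 0 ≤ u → ‖e u‖ ≤ β₂ r u := fun u hu =>
    (B u hu).2.trans ((hβ₂.1 u hu).mono' (norm_nonneg _) hφ)
  have he2 : ∀ s τ, 0 ≤ s → s ≤ τ → ‖seg δ₂ e he τ‖ ≤ η r s := by
    intro s τ hs hsτ
    refine seg_norm_le e he ((hηKL.1 s hs).nonneg' hr0) fun θ h1 h2 => ?_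
    have hb0 : 0 ≤ β₂ r (max (s - δ₂) 0) := (hβ₂.1 _ (le_max_right _ _)).nonneg' hr0
    rcases le_or_gt 0 (τ + θ) with h | h
    · have h3 : β₂ r (τ + θ) ≤ β₂ r (max (s - δ₂) 0) :=
        (hβ₂.2 r hr0).1 (mem_Ici.2 (le_max_right _ _)) (mem_Ici.2 h)
          (max_le (by linarith) h)
      have h4 : 0 ≤ r * Real.exp (δ₂ - s) := by positivity
      have h5 := he1 _ h
      simp only [hη]
      linarith
    · have h3 : ‖e (τ + θ)‖ ≤ r :=
        (norm_le_seg_zero (δ := δ₂) e he (by linarith) h.le).trans hφ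
      have h4 : 1 ≤ Real.exp (δ₂ - s) := Real.one_le_exp (by linarith)
      have h5 : r * 1 ≤ r * Real.exp (δ₂ - s) := mul_le_mul_of_nonneg_left h4 hr0
      simp only [hη]
      linarith
  -- boundedness of x
  have hx1 : ∀ u, 0 ≤ u → ‖x u‖ ≤ β₁ r 0 + γ₁ (η r 0) := by
    intro u hu
    refine (B u hu).1.trans (add_le_add ?_ ?_)
    · exact ((hβ₁.1 u hu).mono' (norm_nonneg _) hψ).trans
        ((hβ₁.2 r hr0).1 (mem_Ici.2 le_rfl) (mem_Ici.2 hu) hu)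
    · refine hγ₁.mono' (Real.sSup_nonneg ?_) (csSup_le ((nonempty_Icc.2 hu).image _) ?_)
      · rintro _ ⟨s, _, rfl⟩
        exact norm_nonneg _
      · rintro _ ⟨s, hs, rfl⟩
        exact he2 0 s le_rfl hs.1
  have hpos : 0 ≤ β₁ r 0 + γ₁ (η r 0) := (norm_nonneg _).trans (hx1 0 le_rfl)
  have hx2 : ∀ s, 0 ≤ s → ‖seg δ₁ x hx s‖ ≤ M r := by
    intro s hs
    refine seg_norm_le x hx (hMK.nonneg' hr0) fun θ h1 h2 => ?_
    simp only [hM]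
    rcases le_or_gt 0 (s + θ) with h | h
    · have := hx1 _ h
      linarith
    · have := (norm_le_seg_zero (δ := δ₁) x hx (by linarith) h.le).trans hψ
      linarith
  -- restart at t / 2
  have hs0 : 0 ≤ t / 2 := hhalf0 t ht
  have hxs : Continuous fun u => x (u + t / 2) := by fun_prop
  have hes : Continuous fun u => e (u + t / 2) := by fun_prop
  have R := (hbounds (fun u => x (u + t / 2)) (fun u => e (u + t / 2)) hxs hes
    (fun u hu => by
      rw [seg_shift δ₁ x hx, seg_shift δ₂ e he]
      exact (hdx (u + t / 2) (by linarith)).comp_add_const u (t / 2))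
    (fun u hu => by
      rw [seg_shift δ₁ x hx, seg_shift δ₂ e he]
      exact (hde (u + t / 2) (by linarith)).comp_add_const u (t / 2)) (t / 2) hs0).1
  rw [add_halves, seg_shift δ₁ x hx, zero_add] at R
  have hxt : ‖x t‖ ≤ β₁ (M r) (t / 2) + γ₁ (η r (t / 2)) := by
    refine R.trans (add_le_add ((hβ₁.1 _ hs0).mono' (norm_nonneg _) (hx2 _ hs0)) ?_)
    refine hγ₁.mono' (Real.sSup_nonneg ?_) (csSup_le ((nonempty_Icc.2 hs0).image _) ?_)
    · rintro _ ⟨s, _, rfl⟩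
      exact norm_nonneg _
    · rintro _ ⟨s, hs, rfl⟩
      show ‖seg δ₂ (fun u => e (u + t / 2)) hes s‖ ≤ _
      rw [seg_shift δ₂ e he]
      exact he2 _ _ hs0 (by linarith [hs.1])
  have hsq : Real.sqrt (‖x t‖ ^ 2 + ‖e t‖ ^ 2) ≤ ‖x t‖ + ‖e t‖ := by
    rw [Real.sqrt_le_left (by positivity)]
    nlinarith [norm_nonneg (x t), norm_nonneg (e t),
      mul_nonneg (norm_nonneg (x t)) (norm_nonneg (e t))]
  exact hsq.trans (add_le_add hxt (he1 t ht))
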